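/- The current operators on ℱ satisfy the Heisenberg commutation relations [J_n, J_m] = n δ_{n+m,0}·id for all n, m ∈ ℤ. -/

import Mathlib

/-!
Fermion Fock space, following J.E. Andersen & K. Ueno,
"Abelian Conformal Field Theory and Determinant Bundles".

Encoding conventions:
* The integer `a : ℤ` encodes the half integer `a + 1/2 ∈ 𝐙_h`.
* A Maya diagram is encoded by its set of entries
  `S = {a : ℤ | ē_{a + 1/2} occurs in the semi-infinite wedge}`;
  such a set contains all sufficiently negative integers and no sufficiently
  positive ones.  This is equivalent to the description via the strictly
  increasing characteristic function `μ` (namely `S` is the image of `μ`,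
  shifted by `-1/2`).
-/

noncomputable section
open scoped Classical

namespace AbCFT

/-- The predicate describing (the entry sets of) Maya diagrams. -/
def IsMayaSet (S : Set ℤ) : Prop :=
  (∃ n₀ : ℤ, ∀ a : ℤ, a < n₀ → a ∈ S) ∧ (∃ n₁ : ℤ, ∀ a : ℤ, n₁ ≤ a → a ∉ S)

/-- A Maya diagram (of arbitrary charge), encoded by its set of entries. -/
def Maya : Type := {S : Set ℤ // IsMayaSet S}

lemma IsMayaSet.erase {S : Set ℤ} (h : IsMayaSet S) (a : ℤ) : IsMayaSet (S \ {a}) := by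
  obtain ⟨⟨n₀, h₀⟩, n₁, h₁⟩ := h
  constructor
  · refine ⟨min n₀ a, fun b hb => ⟨h₀ b (by omega), ?_⟩⟩
    simp only [Set.mem_singleton_iff]
    omega
  · exact ⟨n₁, fun b hb hb' => h₁ b hb hb'.1⟩

lemma IsMayaSet.insert {S : Set ℤ} (h : IsMayaSet S) (a : ℤ) : IsMayaSet (insert a S) := by
  obtain ⟨⟨n₀, h₀⟩, n₁, h₁⟩ := h
  constructor
  · exact ⟨n₀, fun b hb => Set.mem_insert_of_mem _ (h₀ b hb)⟩
  · refine ⟨max n₁ (a + 1), fun b hb hb' => ?_⟩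
    rcases hb' with rfl | hb'
    · have : b + 1 ≤ b := le_trans (le_max_right n₁ (b + 1)) hb
      omega
    · exact h₁ b (le_trans (le_max_left _ _) hb) hb'

/-- The dual fermion Fock space `ℱ = ⊕ₚ ℱ(p)`: the free `ℂ`-vector space on the
set of all Maya diagrams. -/
abbrev FockF : Type := Maya →₀ ℂ

/-- The basis vector `|M⟩` of `ℱ`. -/
def ket (m : Maya) : FockF := Finsupp.single m 1

/-- The number of entries of `S` lying (strictly) above `a`; this governs the
Koszul signs of the fermion operators. -/
def cntAbove (S : Set ℤ) (a : ℤ) : ℕ := {b : ℤ | b ∈ S ∧ a < b}.ncard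

/-- Removing an entry from a Maya diagram. -/
def mayaErase (m : Maya) (a : ℤ) : Maya := ⟨m.1 \ {a}, m.2.erase a⟩

/-- Inserting an entry into a Maya diagram. -/
def mayaInsert (m : Maya) (a : ℤ) : Maya := ⟨insert a m.1, m.2.insert a⟩

/-- `ψ_{a+1/2} |M⟩`: the interior product `i(ē_{a+1/2})`, deleting the factor
`ē_{a+1/2}` with its Koszul sign. -/
def psiKet (a : ℤ) (m : Maya) : FockF :=
  if a ∈ m.1 then ((-1 : ℂ) ^ cntAbove m.1 a) • ket (mayaErase m a) else 0

/-- `ψ̄_{a+1/2} |M⟩`: exterior multiplication `ē_{-(a+1/2)} ∧ ·` in front,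
with its Koszul sign. -/
def psibarKet (a : ℤ) (m : Maya) : FockF :=
  if (-a - 1) ∈ m.1 then 0
  else ((-1 : ℂ) ^ cntAbove m.1 (-a - 1)) • ket (mayaInsert m (-a - 1))

/-- The fermion operator `ψ_ν` (for `ν = a + 1/2`) acting on `ℱ` from the left. -/
def psi (a : ℤ) : FockF →ₗ[ℂ] FockF := Finsupp.linearCombination ℂ (psiKet a)

/-- The fermion operator `ψ̄_ν` (for `ν = a + 1/2`) acting on `ℱ` from the left. -/
def psibar (a : ℤ) : FockF →ₗ[ℂ] FockF := Finsupp.linearCombination ℂ (psibarKet a)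

/-- The charge of a Maya diagram. -/
def charge (m : Maya) : ℤ :=
  ({b : ℤ | b ∈ m.1 ∧ 0 ≤ b}.ncard : ℤ) - ({b : ℤ | b < 0 ∧ b ∉ m.1}.ncard : ℤ)

/-- The degree `d(M) = Σ_ν (μ(ν) - ν)` of a Maya diagram, expressed in terms of
the entry set. -/
def degree (m : Maya) : ℤ :=
  (∑ᶠ b ∈ {b : ℤ | b ∈ m.1 ∧ 0 ≤ b}, (b + 1)) +
    (∑ᶠ b ∈ {b : ℤ | b < 0 ∧ b ∉ m.1}, (-b - 1)) -
    charge m * (charge m + 1) / 2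

/-- The vacuum Maya diagram of charge `p`:  `|p⟩ = ē_{p-1/2} ∧ ē_{p-3/2} ∧ ⋯`. -/
def vacMaya (p : ℤ) : Maya :=
  ⟨{a : ℤ | a < p}, ⟨p, fun _ ha => ha⟩, ⟨p, fun a ha h => by
    simp only [Set.mem_setOf_eq] at h; omega⟩⟩

/-- The vacuum vector `|p⟩ ∈ ℱ(p)`. -/
def ketVac (p : ℤ) : FockF := ket (vacMaya p)

/-- The charge-`p` summand `ℱ(p) ⊆ ℱ`. -/
def Fcharge (p : ℤ) : Submodule ℂ FockF :=
  Submodule.span ℂ (ket '' {m : Maya | charge m = p})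

/-- The graded piece `ℱ_d(p) ⊆ ℱ(p)` spanned by the Maya diagrams of charge `p`
and degree `d` (it is `0` when `d < 0`). -/
def Fgraded (d p : ℤ) : Submodule ℂ FockF :=
  Submodule.span ℂ (ket '' {m : Maya | charge m = p ∧ degree m = d})

/-- The summand `:ψ̄_{n-ν} ψ_ν:` (with `ν = a + 1/2`) of the current operator `J_n`. -/
def jterm (n a : ℤ) : FockF →ₗ[ℂ] FockF :=
  if a < 0 ∧ 0 ≤ n - a - 1 then -(psi a ∘ₗ psibar (n - a - 1))
  else psibar (n - a - 1) ∘ₗ psi a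

/-- The current operator `J_n = Σ_ν :ψ̄_{n-ν} ψ_ν:` on `ℱ` (a locally finite sum,
defined on basis vectors and extended linearly). -/
def Jop (n : ℤ) : FockF →ₗ[ℂ] FockF :=
  Finsupp.linearCombination ℂ (fun m => ∑ᶠ a : ℤ, jterm n a (ket m))

@[simp] lemma psi_ket (a : ℤ) (m : Maya) : psi a (ket m) = psiKet a m := by
  simp [psi, ket]

@[simp] lemma psibar_ket (a : ℤ) (m : Maya) : psibar a (ket m) = psibarKet a m := by
  simp [psibar, ket]

lemma hom_ext_ket {f g : FockF →ₗ[ℂ] FockF} (h : ∀ m, f (ket m) = g (ket m)) : f = g :=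
  Finsupp.lhom_ext' fun m => LinearMap.ext_ring (h m)

lemma IsMayaSet.finite_above {S : Set ℤ} (h : IsMayaSet S) (a : ℤ) :
    {b : ℤ | b ∈ S ∧ a < b}.Finite := by
  obtain ⟨-, n₁, h₁⟩ := h
  refine (Set.finite_Ioo a n₁).subset fun b hb => ⟨hb.2, ?_⟩
  by_contra! hn
  exact h₁ b hn hb.1

lemma neg_one_pow_cntAbove_insert {S : Set ℤ} (h : IsMayaSet S) {a : ℤ} (ha : a ∉ S) (c : ℤ) :
    (-1 : ℂ) ^ cntAbove (insert a S) c =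
      if c < a then -(-1 : ℂ) ^ cntAbove S c else (-1 : ℂ) ^ cntAbove S c := by
  unfold cntAbove
  split_ifs with hc
  · have : {b : ℤ | b ∈ insert a S ∧ c < b} = insert a {b : ℤ | b ∈ S ∧ c < b} := by
      ext b
      simp only [Set.mem_ofPred_eq, Set.mem_insert_iff]
      grind
    rw [this, Set.ncard_insert_of_notMem (by simp [ha]) (h.finite_above c), pow_succ]
    ring
  · congr 2
    ext b
    simp only [Set.mem_ofPred_eq, Set.mem_insert_iff]
    grind

lemma neg_one_pow_cntAbove_erase {S : Set ℤ} (h : IsMayaSet S) {a : ℤ} (ha : a ∈ S) (c : ℤ) :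
    (-1 : ℂ) ^ cntAbove (S \ {a}) c =
      if c < a then -(-1 : ℂ) ^ cntAbove S c else (-1 : ℂ) ^ cntAbove S c := by
  have := neg_one_pow_cntAbove_insert (h.erase a) (a := a) (by simp) c
  rw [Set.insert_sdiff_singleton, Set.insert_eq_of_mem ha] at this
  split_ifs at this ⊢ <;> simp [this]

/-- Exterior multiplication by `ē_{b+1/2}`. -/
def wedge (b : ℤ) : Module.End ℂ FockF := psibar (-b - 1)

/-- The interior product `psi` viewed in the endomorphism ring. -/
def contract (a : ℤ) : Module.End ℂ FockF := psi a

lemma contract_ket (a : ℤ) (m : Maya) : contract a (ket m) =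
    if a ∈ m.1 then ((-1 : ℂ) ^ cntAbove m.1 a) • ket (mayaErase m a) else 0 :=
  psi_ket a m

lemma wedge_ket (b : ℤ) (m : Maya) : wedge b (ket m) =
    if b ∈ m.1 then 0 else ((-1 : ℂ) ^ cntAbove m.1 b) • ket (mayaInsert m b) := by
  have : -(-b - 1) - 1 = b := by ring
  simp only [wedge, psibar_ket, psibarKet, this]

lemma mem_mayaErase {m : Maya} {a b : ℤ} : b ∈ (mayaErase m a).1 ↔ b ∈ m.1 ∧ b ≠ a := Iff.rfl

lemma mem_mayaInsert {m : Maya} {a b : ℤ} : b ∈ (mayaInsert m a).1 ↔ b = a ∨ b ∈ m.1 := Iff.rfl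

lemma mayaErase_comm (m : Maya) (a b : ℤ) :
    mayaErase (mayaErase m a) b = mayaErase (mayaErase m b) a :=
  Subtype.ext <| Set.ext fun x => by simp only [mem_mayaErase]; tauto

lemma mayaInsert_comm (m : Maya) (a b : ℤ) :
    mayaInsert (mayaInsert m a) b = mayaInsert (mayaInsert m b) a :=
  Subtype.ext <| Set.ext fun x => by simp only [mem_mayaInsert]; tauto

lemma mayaErase_mayaInsert_of_ne (m : Maya) {a b : ℤ} (h : a ≠ b) :
    mayaErase (mayaInsert m b) a = mayaInsert (mayaErase m a) b :=
  Subtype.ext <| Set.ext fun x => by simp only [mem_mayaErase, mem_mayaInsert]; grind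

lemma mayaErase_mayaInsert_self {m : Maya} {a : ℤ} (h : a ∉ m.1) :
    mayaErase (mayaInsert m a) a = m :=
  Subtype.ext <| Set.ext fun x => by simp only [mem_mayaErase, mem_mayaInsert]; grind

lemma mayaInsert_mayaErase_self {m : Maya} {a : ℤ} (h : a ∈ m.1) :
    mayaInsert (mayaErase m a) a = m :=
  Subtype.ext <| Set.ext fun x => by simp only [mem_mayaErase, mem_mayaInsert]; grind

lemma neg_one_pow_cntAbove_mayaInsert {m : Maya} {a : ℤ} (ha : a ∉ m.1) (c : ℤ) :
    (-1 : ℂ) ^ cntAbove (mayaInsert m a).1 c =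
      if c < a then -(-1 : ℂ) ^ cntAbove m.1 c else (-1 : ℂ) ^ cntAbove m.1 c :=
  neg_one_pow_cntAbove_insert m.2 ha c

lemma neg_one_pow_cntAbove_mayaErase {m : Maya} {a : ℤ} (ha : a ∈ m.1) (c : ℤ) :
    (-1 : ℂ) ^ cntAbove (mayaErase m a).1 c =
      if c < a then -(-1 : ℂ) ^ cntAbove m.1 c else (-1 : ℂ) ^ cntAbove m.1 c :=
  neg_one_pow_cntAbove_erase m.2 ha c

lemma contract_mul_contract (a c : ℤ) : contract a * contract c = -(contract c * contract a) := by
  refine hom_ext_ket fun m => ?_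
  by_cases hac : a = c
  · subst hac
    by_cases ha : a ∈ m.1 <;> simp [contract_ket, ha, mem_mayaErase]
  by_cases ha : a ∈ m.1 <;> by_cases hc : c ∈ m.1 <;>
    simp [contract_ket, ha, hc, mem_mayaErase, hac, Ne.symm hac]
  rw [neg_one_pow_cntAbove_mayaErase ha, neg_one_pow_cntAbove_mayaErase hc, smul_smul, smul_smul,
    ← neg_smul, mayaErase_comm]
  congr 1
  rcases lt_or_gt_of_ne hac with h | h <;> simp [h, h.not_gt, mul_comm]

lemma wedge_mul_wedge (a c : ℤ) : wedge a * wedge c = -(wedge c * wedge a) := by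
  refine hom_ext_ket fun m => ?_
  by_cases hac : a = c
  · subst hac
    by_cases ha : a ∈ m.1 <;> simp [wedge_ket, ha, mem_mayaInsert]
  by_cases ha : a ∈ m.1 <;> by_cases hc : c ∈ m.1 <;>
    simp [wedge_ket, ha, hc, mem_mayaInsert, hac, Ne.symm hac]
  rw [neg_one_pow_cntAbove_mayaInsert ha, neg_one_pow_cntAbove_mayaInsert hc, smul_smul, smul_smul,
    ← neg_smul, mayaInsert_comm]
  congr 1
  rcases lt_or_gt_of_ne hac with h | h <;> simp [h, h.not_gt, mul_comm]

lemma contract_mul_wedge (a b : ℤ) :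
    contract a * wedge b = (if a = b then 1 else 0) - wedge b * contract a := by
  refine hom_ext_ket fun m => ?_
  by_cases hab : a = b
  · subst hab
    by_cases ha : a ∈ m.1
    · simp [wedge_ket, contract_ket, ha, mem_mayaErase, mayaInsert_mayaErase_self ha,
        neg_one_pow_cntAbove_mayaErase ha, smul_smul, ← mul_pow]
    · simp [wedge_ket, contract_ket, ha, mem_mayaInsert, mayaErase_mayaInsert_self ha,
        neg_one_pow_cntAbove_mayaInsert ha, smul_smul, ← mul_pow]
  by_cases ha : a ∈ m.1 <;> by_cases hb : b ∈ m.1 <;>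
    simp [wedge_ket, contract_ket, ha, hb, mem_mayaInsert, mem_mayaErase, hab, Ne.symm hab]
  rw [neg_one_pow_cntAbove_mayaErase ha, neg_one_pow_cntAbove_mayaInsert hb, smul_smul, smul_smul,
    ← neg_smul, mayaErase_mayaInsert_of_ne m hab]
  congr 1
  rcases lt_or_gt_of_ne hab with h | h <;> simp [h, h.not_gt, mul_comm]

lemma bilinear_commutator_of_anticommute {R : Type*} [Ring R] {w₁ w₂ c₁ c₂ s t : R}
    (hw : w₁ * w₂ = -(w₂ * w₁)) (hc : c₁ * c₂ = -(c₂ * c₁))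
    (h₁₂ : c₁ * w₂ = s - w₂ * c₁) (h₂₁ : c₂ * w₁ = t - w₁ * c₂) :
    w₁ * c₁ * (w₂ * c₂) - w₂ * c₂ * (w₁ * c₁) = w₁ * s * c₂ - w₂ * t * c₁ := by
  have e₁ : w₁ * c₁ * (w₂ * c₂) = w₁ * s * c₂ - w₁ * w₂ * (c₁ * c₂) := by
    rw [mul_assoc, ← mul_assoc c₁, h₁₂]; noncomm_ring
  have e₂ : w₂ * c₂ * (w₁ * c₁) = w₂ * t * c₁ - w₂ * w₁ * (c₂ * c₁) := by
    rw [mul_assoc, ← mul_assoc c₂, h₂₁]; noncomm_ring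
  rw [e₁, e₂, hw, hc]
  noncomm_ring

/-- The bilinear `ē_{b+1/2} ∧ i(ē_{a+1/2})`. -/
def bilin (b a : ℤ) : Module.End ℂ FockF := wedge b * contract a

lemma bilin_commutator (b a d c : ℤ) :
    bilin b a * bilin d c - bilin d c * bilin b a =
      (if a = d then bilin b c else 0) - if c = b then bilin d a else 0 := by
  have h₁ : (if a = d then bilin b c else 0) =
      wedge b * (if a = d then 1 else 0) * contract c := by split_ifs <;> simp [bilin]
  have h₂ : (if c = b then bilin d a else 0) =
      wedge d * (if c = b then 1 else 0) * contract a := by split_ifs <;> simp [bilin]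
  rw [h₁, h₂]
  exact bilinear_commutator_of_anticommute (R := Module.End ℂ FockF) (wedge_mul_wedge b d)
    (contract_mul_contract a c) (contract_mul_wedge a d) (contract_mul_wedge c b)

lemma jterm_eq (n a : ℤ) :
    jterm n a = bilin (a - n) a - if n = 0 ∧ a < 0 then (1 : Module.End ℂ FockF) else 0 := by
  have hw : psibar (n - a - 1) = wedge (a - n) := by
    unfold wedge; congr 1; ring
  have hc := contract_mul_wedge a (a - n)
  have hn : a = a - n ↔ n = 0 := by omega
  simp only [hn] at hc
  unfold jterm
  rw [hw]
  change (if _ then -(contract a * wedge (a - n)) else bilin (a - n) a) = _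
  rw [hc]
  refine LinearMap.ext fun v => ?_
  split_ifs <;> first | omega | simp [bilin]

lemma finite_support_jterm (n : ℤ) (v : FockF) :
    (Function.support fun a => jterm n a v).Finite := by
  induction v using Finsupp.induction_linear with
  | zero => simp
  | add f g hf hg =>
    simp only [map_add]
    exact (hf.union hg).subset (Function.support_add _ _)
  | single m z =>
    obtain ⟨n₀, h₀⟩ := m.2.1
    obtain ⟨n₁, h₁⟩ := m.2.2
    have hz : Finsupp.single m z = z • ket m := by simp [ket]
    refine (Set.finite_Icc (min (min n₀ (n₀ + n)) 0) (max n₁ 0)).subset fun a ha => ?_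
    by_contra hout
    refine ha ?_
    simp only [Set.mem_Icc, not_and_or, not_le] at hout
    have key : jterm n a (ket m) = 0 := by
      rw [jterm_eq]
      rcases hout with h | h
      · have hw : wedge (a - n) (ket m) = 0 := by
          rw [wedge_ket, if_pos (h₀ _ (by omega))]
        have hc := congrArg (· (ket m)) (contract_mul_wedge a (a - n))
        simp only [Module.End.mul_apply, hw, map_zero, LinearMap.sub_apply] at hc
        have hb : bilin (a - n) a (ket m) = (if a = a - n then (1 : Module.End ℂ FockF) else 0)
            (ket m) := (sub_eq_zero.mp hc.symm).symm
        have hiff : (n = 0 ∧ a < 0) ↔ a = a - n := by omega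
        rw [LinearMap.sub_apply, hb]
        simp only [hiff, sub_self]
      · have hc : contract a (ket m) = 0 := by
          rw [contract_ket, if_neg (h₁ _ (by omega))]
        have hneg : ¬ (n = 0 ∧ a < 0) := by omega
        simp [bilin, hc, hneg]
    simp [hz, key]

lemma Jop_apply (n : ℤ) (v : FockF) : Jop n v = ∑ᶠ a : ℤ, jterm n a v := by
  induction v using Finsupp.induction_linear with
  | zero => simp
  | add f g hf hg =>
    simp only [map_add, hf, hg]
    exact (finsum_add_distrib (finite_support_jterm n f) (finite_support_jterm n g)).symm
  | single m z =>
    have hz : Finsupp.single m z = z • ket m := by simp [ket]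
    rw [hz]
    simp only [map_smul]
    rw [← smul_finsum' _ (finite_support_jterm n (ket m))]
    simp [Jop, ket]

lemma Jop_commutator_bilin (n d c : ℤ) (v : FockF) :
    Jop n (bilin d c v) - bilin d c (Jop n v) = bilin (d - n) c v - bilin d (c + n) v := by
  have hmap : bilin d c (Jop n v) = ∑ᶠ a, bilin d c (jterm n a v) := by
    rw [Jop_apply]
    exact (bilin d c).toAddMonoidHom.map_finsum (finite_support_jterm n v)
  rw [hmap, Jop_apply, ← finsum_sub_distrib (finite_support_jterm n _)
    ((finite_support_jterm n v).subset fun a ha h => ha (by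
      simp only at h; simp [h]))]
  have hterm (a : ℤ) : jterm n a (bilin d c v) - bilin d c (jterm n a v) =
      (if a = d then bilin (d - n) c v else 0) - if a = c + n then bilin d (c + n) v else 0 := by
    have hc := congrArg (· v) (bilin_commutator (a - n) a d c)
    have hiff : c = a - n ↔ a = c + n := by omega
    simp only [LinearMap.sub_apply, Module.End.mul_apply, hiff] at hc
    rw [jterm_eq]
    trans bilin (a - n) a (bilin d c v) - bilin d c (bilin (a - n) a v)
    · split_ifs <;> simp
    · rw [hc]
      congr 1 <;> split_ifs with h <;> simp [h]
  simp only [hterm]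
  rw [finsum_sub_distrib ((Set.finite_singleton d).subset (by simp +contextual))
    ((Set.finite_singleton (c + n)).subset (by simp +contextual))]
  rw [finsum_eq_single _ d (by simp +contextual), finsum_eq_single _ (c + n) (by simp +contextual),
    if_pos rfl, if_pos rfl]

lemma finite_support_ite_neg_sub_ite_add_neg (n : ℤ) (v : FockF) :
    (Function.support fun c : ℤ =>
      (if c < 0 then v else 0) - if c + n < 0 then v else 0).Finite := by
  refine (Set.finite_Icc (min 0 (-n)) (max 0 (-n))).subset fun c hc => ?_
  by_contra hout
  simp only [Set.mem_Icc, not_and_or, not_le] at hout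
  refine hc ?_
  beta_reduce
  split_ifs <;> first | omega | simp

lemma finsum_ite_neg_sub_ite_add_neg (n : ℤ) (v : FockF) :
    ∑ᶠ c : ℤ, ((if c < 0 then v else 0) - if c + n < 0 then v else 0) = (n : ℂ) • v := by
  have hsum : ∀ c : ℤ, ((if c < 0 then v else 0) - if c + n < 0 then v else 0) =
      (if c ∈ Finset.Ico (-n) 0 then v else 0) - if c ∈ Finset.Ico 0 (-n) then v else 0 := by
    intro c
    simp only [Finset.mem_Ico]
    split_ifs <;> first | omega | simp
  have hite (s : Finset ℤ) : ∑ᶠ c, (if c ∈ s then v else 0) = (s.card : ℂ) • v := by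
    rw [finsum_eq_sum_of_support_subset (s := s) _ (by simp +contextual)]
    simp [Nat.cast_smul_eq_nsmul]
  have hfin (s : Finset ℤ) : (Function.support fun c => if c ∈ s then v else 0).Finite :=
    s.finite_toSet.subset (by simp +contextual)
  simp only [hsum]
  rw [finsum_sub_distrib (hfin _) (hfin _), hite, hite, ← sub_smul]
  congr 1
  simp only [Int.card_Ico]
  exact_mod_cast (by omega : ((0 - -n).toNat : ℤ) - ((-n - 0).toNat : ℤ) = n)

/-- The current operators on `ℱ` satisfy the Heisenberg
commutation relations `[J_n, J_m] = n δ_{n+m,0} · id` for all `n, m ∈ ℤ`. -/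
theorem current_commutation_relations (n m : ℤ) :
    Jop n ∘ₗ Jop m - Jop m ∘ₗ Jop n =
      (if n + m = 0 then (n : ℂ) • (LinearMap.id : FockF →ₗ[ℂ] FockF) else 0) := by
  refine LinearMap.ext fun v => ?_
  have hmap : Jop n (Jop m v) = ∑ᶠ c, Jop n (jterm m c v) := by
    rw [Jop_apply m v]
    exact (Jop n).toAddMonoidHom.map_finsum (finite_support_jterm m v)
  have hfin : (Function.support fun c => Jop n (jterm m c v)).Finite :=
    (finite_support_jterm m v).subset fun a ha h => ha (by simp only at h; simp [h])
  set X : ℤ → FockF := fun c => jterm (n + m) c v with hX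
  have hXfin : (Function.support X).Finite := finite_support_jterm (n + m) v
  have hXfin' : (Function.support fun c => X (c + n)).Finite :=
    hXfin.preimage (add_left_injective n).injOn
  have hterm (c : ℤ) : Jop n (jterm m c v) - jterm m c (Jop n v) = (X c - X (c + n)) +
      if n + m = 0 then (if c < 0 then v else 0) - (if c + n < 0 then v else 0) else 0 := by
    have h := Jop_commutator_bilin n (c - m) c v
    have h₁ : c - m - n = c - (n + m) := by ring
    have h₂ : c - m = c + n - (n + m) := by ring
    trans bilin (c - (n + m)) c v - bilin (c + n - (n + m)) (c + n) v
    · rw [← h₁, ← h₂, ← h, jterm_eq]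
      split_ifs <;> simp
    · simp only [hX, jterm_eq]
      split_ifs <;> simp_all
      all_goals abel
  rw [LinearMap.sub_apply, LinearMap.comp_apply, LinearMap.comp_apply]
  rw [hmap, Jop_apply m (Jop n v), ← finsum_sub_distrib hfin (finite_support_jterm m _)]
  simp only [hterm]
  have hshift : ∑ᶠ c, (X c - X (c + n)) = 0 := by
    rw [finsum_sub_distrib hXfin hXfin', sub_eq_zero]
    exact (finsum_comp_equiv (Equiv.addRight n)).symm
  split_ifs with hnm
  · rw [finsum_add_distrib ((hXfin.union hXfin').subset (Function.support_sub _ _))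
      (finite_support_ite_neg_sub_ite_add_neg n v), hshift, finsum_ite_neg_sub_ite_add_neg]
    simp
  · simpa using hshift

end AbCFT
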